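/- arXiv:0801.4699 — 6 statements merged into one kernel-verified Lean document; each statement's English description precedes it below -/
import Mathlib

section
/- Let F : ℕ → ℕ be a cobweb-admissible sequence with F(n) ≥ 1 for all n, and let p be a prime number. Then the sequence P_p : ℕ → ℕ defined by P_p(n) = p^(v_p(F(n))), where v_p denotes the p-adic valuation, is also cobweb-admissible. (In particular every value of P_p is 1 or a power of p, so P_p is a primary cobweb-admissible sequence.) -/
/-- A sequence `F : ℕ → ℕ` is cobweb-admissible iff for all `n, k` with `k ≤ n`,
the product `F 1 * F 2 * ⋯ * F k` divides `F (n-k+1) * ⋯ * F n`. -/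
def CobwebAdmissible (F : ℕ → ℕ) : Prop :=
  ∀ n k : ℕ, k ≤ n → (∏ i ∈ Finset.Icc 1 k, F i) ∣ ∏ i ∈ Finset.Icc (n - k + 1) n, F i

/-- The `p`-primary part `p ^ v_p` is multiplicative over finite products of nonzero naturals. -/
theorem prod_ordProj (F : ℕ → ℕ) (hF : ∀ n, 1 ≤ F n) (p : ℕ) (s : Finset ℕ) :
    ∏ i ∈ s, p ^ (F i).factorization p = p ^ (∏ i ∈ s, F i).factorization p := by
  rw [Finset.prod_pow_eq_pow_sum,
    Nat.factorization_prod fun i _ => Nat.one_le_iff_ne_zero.mp (hF i), Finsupp.finsetSum_apply]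

theorem primary_component_cobweb_admissible (F : ℕ → ℕ) (hF : ∀ n, 1 ≤ F n)
    (hadm : CobwebAdmissible F) (p : ℕ) (hp : p.Prime) :
    CobwebAdmissible (fun n => p ^ (F n).factorization p) := by
  intro n k hk
  simp only [prod_ordProj F hF]
  have prod_ne_zero (s : Finset ℕ) : ∏ i ∈ s, F i ≠ 0 :=
    Finset.prod_ne_zero_iff.mpr fun i _ => Nat.one_le_iff_ne_zero.mp (hF i)
  exact pow_dvd_pow p
    ((Nat.factorization_le_iff_dvd (prod_ne_zero _) (prod_ne_zero _)).mpr (hadm n k hk) p)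
end

section
/- For every n ≥ 1, a positive integer sequence F : ℕ → ℕ with F(n) ≥ 1 satisfies F(n) = ∏_p p^(v_p(F(n))), where the product ranges over the primes p dividing F(n); hence any cobweb-admissible sequence F is the pointwise product, over primes p, of the sequences P_p(n) = p^(v_p(F(n))), each of which is a primary cobweb-admissible sequence (Theorem 1 of the paper). -/
/-- The `p`-part of a finite product of nonzero naturals is the product of the `p`-parts. -/
theorem prod_pow_factorization_eq {ι : Type*} (s : Finset ι) (f : ι → ℕ) (hf : ∀ i ∈ s, f i ≠ 0)
    (p : ℕ) :
    ∏ i ∈ s, p ^ (f i).factorization p = p ^ (∏ i ∈ s, f i).factorization p := by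
  rw [Finset.prod_pow_eq_pow_sum, Nat.factorization_prod hf, Finsupp.finsetSum_apply]

/-- Taking `p`-parts preserves cobweb-admissibility. -/
theorem CobwebAdmissible.pow_factorization {F : ℕ → ℕ} (hadm : CobwebAdmissible F)
    (hF : ∀ n, F n ≠ 0) (p : ℕ) : CobwebAdmissible (fun n => p ^ (F n).factorization p) := by
  intro n k hk
  rw [prod_pow_factorization_eq _ _ (fun i _ => hF i),
    prod_pow_factorization_eq _ _ (fun i _ => hF i)]
  have h := (Nat.factorization_le_iff_dvd (Finset.prod_ne_zero_iff.2 fun i _ => hF i)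
    (Finset.prod_ne_zero_iff.2 fun i _ => hF i)).2 (hadm n k hk)
  exact pow_dvd_pow p (h p)

theorem cobweb_pointwise_product_of_primary (F : ℕ → ℕ) (hF : ∀ n, 1 ≤ F n)
    (hadm : CobwebAdmissible F) :
    (∀ n, 1 ≤ n → F n = ∏ p ∈ (F n).primeFactors, p ^ (F n).factorization p) ∧
    (∀ p : ℕ, p.Prime →
      CobwebAdmissible (fun n => p ^ (F n).factorization p) ∧
      (∀ n, ∃ m : ℕ, p ^ (F n).factorization p = p ^ m)) := by
  have hF0 : ∀ n, F n ≠ 0 := fun n => Nat.one_le_iff_ne_zero.1 (hF n)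
  exact ⟨fun n _ => (Nat.prod_factorization_pow_eq_self (hF0 n)).symm,
    fun p _ => ⟨hadm.pow_factorization hF0 p, fun n => ⟨_, rfl⟩⟩⟩
end

section
/- (Production Theorem) A sequence F : ℕ → ℕ with F(n) ≥ 1 for all n is cobweb-admissible if and only if for every prime p the sequence P_p : ℕ → ℕ defined by P_p(n) = p^(v_p(F(n))) is cobweb-admissible. -/
theorem prod_dvd_prod_iff_sum_factorization_le {ι : Type*} (F : ι → ℕ) (hF : ∀ i, F i ≠ 0)
    (s t : Finset ι) :
    (∏ i ∈ s, F i) ∣ ∏ i ∈ t, F i ↔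
      ∀ p : ℕ, p.Prime → ∑ i ∈ s, (F i).factorization p ≤ ∑ i ∈ t, (F i).factorization p := by
  rw [← Nat.factorization_prime_le_iff_dvd (Finset.prod_ne_zero_iff.2 fun i _ => hF i)
    (Finset.prod_ne_zero_iff.2 fun i _ => hF i)]
  simp only [Nat.factorization_prod fun i _ => hF i, Finsupp.finsetSum_apply]

theorem cobweb_production_theorem (F : ℕ → ℕ) (hF : ∀ n, 1 ≤ F n) :
    CobwebAdmissible F ↔
      ∀ p : ℕ, p.Prime → CobwebAdmissible (fun n => p ^ (F n).factorization p) := by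
  have hF₀ : ∀ n, F n ≠ 0 := fun n => Nat.one_le_iff_ne_zero.1 (hF n)
  simp only [CobwebAdmissible, prod_dvd_prod_iff_sum_factorization_le F hF₀,
    Finset.prod_pow_eq_pow_sum]
  constructor
  · intro h p hp n k hk
    exact pow_dvd_pow p (h n k hk p hp)
  · intro h n k hk p hp
    exact (Nat.pow_dvd_pow_iff_le_right hp.one_lt).1 (h p hp n k hk)
end

section
/- (Lemma 1, backward direction) Let p be a prime and b : ℕ → ℕ a sequence of natural numbers such that for every natural number n and every k with 1 ≤ k ≤ ⌊n/2⌋ one has ∑_{s=n−k+1}^{n} b(s) ≥ ∑_{s=1}^{k} b(s). Then the sequence F : ℕ → ℕ defined by F(n) = p^(b(n)) is cobweb-admissible. -/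
theorem sum_Icc_one_add_sum_Icc_sub (b : ℕ → ℕ) (n k : ℕ) :
    ∑ s ∈ Finset.Icc 1 (n - k), b s + ∑ s ∈ Finset.Icc (n - k + 1) n, b s =
      ∑ s ∈ Finset.Icc 1 n, b s := by
  have h := Finset.sum_Ioc_consecutive b (Nat.zero_le (n - k)) (Nat.sub_le n k)
  simpa only [← Finset.Icc_add_one_left_eq_Ioc, zero_add] using h

theorem cobweb_admissible_of_exponent_inequality (p : ℕ) (hp : p.Prime) (b : ℕ → ℕ)
    (hb : ∀ n k : ℕ, 1 ≤ k → k ≤ n / 2 →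
      (∑ s ∈ Finset.Icc 1 k, b s) ≤ ∑ s ∈ Finset.Icc (n - k + 1) n, b s) :
    CobwebAdmissible (fun n => p ^ b n) := by
  intro n k hkn
  simp only [Finset.prod_pow_eq_pow_sum]
  apply pow_dvd_pow
  rcases Nat.eq_zero_or_pos k with rfl | hk
  · simp
  by_cases hk2 : k ≤ n / 2
  · exact hb n k hk hk2
  have h₁ := sum_Icc_one_add_sum_Icc_sub b n k
  have h₂ := sum_Icc_one_add_sum_Icc_sub b n (n - k)
  rw [Nat.sub_sub_self hkn] at h₂
  rcases Nat.eq_zero_or_pos (n - k) with h₀ | h₀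
  · obtain rfl : n = k := by omega
    simp
  have h₃ := hb n (n - k) h₀ (by omega)
  rw [Nat.sub_sub_self hkn] at h₃
  omega
end

section
/- (Half-range reduction) Let b : ℕ → ℕ be a sequence of natural numbers such that for every natural number n and every k with 1 ≤ k ≤ ⌊n/2⌋ one has ∑_{s=n−k+1}^{n} b(s) ≥ ∑_{s=1}^{k} b(s). Then the same inequality holds for every k with 1 ≤ k ≤ n: that is, for all n and all 1 ≤ k ≤ n, ∑_{s=n−k+1}^{n} b(s) ≥ ∑_{s=1}^{k} b(s). -/
theorem sum_Icc_one_add_sum_Icc_succ (b : ℕ → ℕ) {m n : ℕ} (h : m ≤ n) :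
    (∑ s ∈ Finset.Icc 1 m, b s) + ∑ s ∈ Finset.Icc (m + 1) n, b s =
      ∑ s ∈ Finset.Icc 1 n, b s := by
  have hIcc (i j : ℕ) : Finset.Icc (i + 1) j = Finset.Ioc i j := by
    ext x
    simp only [Finset.mem_Icc, Finset.mem_Ioc]
    omega
  simpa only [← hIcc, zero_add] using Finset.sum_Ioc_consecutive b (Nat.zero_le m) h

theorem cobweb_inequality_half_range_reduction (b : ℕ → ℕ)
    (hb : ∀ n k : ℕ, 1 ≤ k → k ≤ n / 2 →
      (∑ s ∈ Finset.Icc 1 k, b s) ≤ ∑ s ∈ Finset.Icc (n - k + 1) n, b s) :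
    ∀ n k : ℕ, 1 ≤ k → k ≤ n →
      (∑ s ∈ Finset.Icc 1 k, b s) ≤ ∑ s ∈ Finset.Icc (n - k + 1) n, b s := by
  intro n k hk hkn
  rcases le_or_gt k (n / 2) with h | h
  · exact hb n k hk h
  rcases hkn.eq_or_lt with rfl | hlt
  · simp
  have hcompl := hb n (n - k) (by omega) (by omega)
  rw [Nat.sub_sub_self hkn] at hcompl
  have hsplit := sum_Icc_one_add_sum_Icc_succ b hkn
  have hsplit' := sum_Icc_one_add_sum_Icc_succ b (Nat.sub_le n k)
  omega
end

section
/- (Observation 3: path characterization of the family 𝒜(p)) Let p be a prime and F : ℕ → ℕ a sequence each of whose values F(n) lies in {1, p, p², p³, …}, and let b : ℕ → ℕ be the exponent sequence with F(n) = p^(b(n)). Then F is cobweb-admissible if and only if for every natural number n and every k with 1 ≤ k ≤ ⌊n/2⌋ one has ∑_{s=n−k+1}^{n} b(s) ≥ ∑_{s=1}^{k} b(s). -/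
theorem sum_Icc_one_add_sum_Icc (b : ℕ → ℕ) {m n : ℕ} (h : m ≤ n) :
    ∑ s ∈ Finset.Icc 1 m, b s + ∑ s ∈ Finset.Icc (m + 1) n, b s =
      ∑ s ∈ Finset.Icc 1 n, b s := by
  rw [← Finset.sum_union]
  · congr 1
    ext x
    simp only [Finset.mem_union, Finset.mem_Icc]
    omega
  · rw [Finset.disjoint_left]
    intro x hx hx'
    rw [Finset.mem_Icc] at hx hx'
    omega

theorem cobwebAdmissible_iff_sum_le {p : ℕ} (hp : 1 < p) {F b : ℕ → ℕ}
    (hFb : ∀ n, F n = p ^ b n) :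
    CobwebAdmissible F ↔
      ∀ n k : ℕ, k ≤ n →
        ∑ s ∈ Finset.Icc 1 k, b s ≤ ∑ s ∈ Finset.Icc (n - k + 1) n, b s := by
  simp only [CobwebAdmissible, hFb, Finset.prod_pow_eq_pow_sum,
    Nat.pow_dvd_pow_iff_le_right hp]

theorem cobweb_path_characterization (p : ℕ) (hp : p.Prime) (F b : ℕ → ℕ)
    (hFb : ∀ n, F n = p ^ b n) :
    CobwebAdmissible F ↔
      ∀ n k : ℕ, 1 ≤ k → k ≤ n / 2 →
        (∑ s ∈ Finset.Icc 1 k, b s) ≤ ∑ s ∈ Finset.Icc (n - k + 1) n, b s := by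
  rw [cobwebAdmissible_iff_sum_le hp.one_lt hFb]
  refine ⟨fun h n k _ hk => h n k (by omega), fun h n k hk => ?_⟩
  rcases Nat.eq_zero_or_pos k with rfl | hk0
  · simp
  by_cases hk2 : k ≤ n / 2
  · exact h n k hk0 hk2
  rcases hk.eq_or_lt with rfl | hlt
  · simp
  have hsymm := h n (n - k) (by omega) (by omega)
  rw [Nat.sub_sub_self hk] at hsymm
  have h₁ := sum_Icc_one_add_sum_Icc b hk
  have h₂ := sum_Icc_one_add_sum_Icc b (Nat.sub_le n k)
  omega
end
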